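/- arXiv:0707.0371 — 2 statements merged into one kernel-verified Lean document; each statement's English description precedes it below -/
import Mathlib

section
/- Let K, G, H be groups, A a subgroup of K, B a subgroup of G, g : K → G quadratic relative A, and f : G → H quadratic relative B. Assume (f,g) is a quadratic pair, i.e. g(A) ⊆ B and d_f(x,c) = 1 = d_f(c,x) whenever c ∈ G and x lies in the subgroup D_g of G generated by all values of d_g. Then the composite f ∘ g : K → H is quadratic relative A, with deviation d_{f∘g}(a,b) = f(d_g(a,b)) * d_f(g(a), g(b)) for all a, b ∈ K. -/
section QuadDefs

variable {G : Type*} {H : Type*} [Group G] [Group H]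

/-- The deviation (cross effect) of a map between groups:
`dev f a b = f (a*b) * (f b)⁻¹ * (f a)⁻¹`. -/
def dev (f : G → H) (a b : G) : H := f (a * b) * (f b)⁻¹ * (f a)⁻¹

/-- A map between groups is quadratic if its deviation is bilinear and all of its
values commute with all values of `f`. -/
def IsQuadratic (f : G → H) : Prop :=
  (∀ a a' b : G, dev f (a * a') b = dev f a b * dev f a' b) ∧
  (∀ a b b' : G, dev f a (b * b') = dev f a b * dev f a b') ∧
  (∀ a b c : G, Commute (dev f a b) (f c))

/-- A map between groups is quadratic relative a subgroup `B` if it is quadratic and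
its deviation vanishes as soon as one argument is in `B`. -/
def IsQuadraticRel (f : G → H) (B : Subgroup G) : Prop :=
  IsQuadratic f ∧ ∀ a b : G, (a ∈ B ∨ b ∈ B) → dev f a b = 1

end QuadDefs

section QuadLemmas

variable {G : Type*} {H : Type*} [Group G] [Group H]

theorem map_mul_eq_dev_mul (f : G → H) (a b : G) : f (a * b) = dev f a b * (f a * f b) := by
  simp [dev, mul_assoc]

theorem map_mul_of_dev_eq_one {f : G → H} {a b : G} (h : dev f a b = 1) :
    f (a * b) = f a * f b := by
  rw [map_mul_eq_dev_mul f, h, one_mul]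

theorem IsQuadraticRel.map_one {f : G → H} {B : Subgroup G} (hf : IsQuadraticRel f B) :
    f 1 = 1 := by
  simpa [dev] using hf.2 1 1 (Or.inl B.one_mem)

end QuadLemmas

theorem stmt4 {K G H : Type*} [Group K] [Group G] [Group H]
    (A : Subgroup K) (B : Subgroup G) (g : K → G) (f : G → H)
    (hg : IsQuadraticRel g A) (hf : IsQuadraticRel f B)
    (hgA : ∀ a ∈ A, g a ∈ B)
    (hpair : ∀ x ∈ Subgroup.closure {y : G | ∃ a b : K, dev g a b = y}, ∀ c : G,
      dev f x c = 1 ∧ dev f c x = 1) :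
    IsQuadraticRel (f ∘ g) A ∧
    ∀ a b : K, dev (f ∘ g) a b = f (dev g a b) * dev f (g a) (g b) := by
  have hx : ∀ a b c, dev f (dev g a b) c = 1 ∧ dev f c (dev g a b) = 1 := fun a b =>
    hpair _ (Subgroup.subset_closure ⟨a, b, rfl⟩)
  obtain ⟨⟨gl, gr, gc⟩, hgA'⟩ := hg
  have hf1 := hf.map_one
  obtain ⟨⟨fl, fr, fc⟩, hfB⟩ := hf
  have key : ∀ a b, dev (f ∘ g) a b = f (dev g a b) * dev f (g a) (g b) := fun a b => by
    have h : f (g (a * b)) = f (dev g a b) * (dev f (g a) (g b) * (f (g a) * f (g b))) := by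
      rw [map_mul_eq_dev_mul g, map_mul_of_dev_eq_one (hx a b _).1, map_mul_eq_dev_mul f (g a)]
    simp only [dev, Function.comp_apply] at h ⊢
    rw [h]
    group
  have hcomm : ∀ a b c, Commute (f (dev g a b)) (f (g c)) := fun a b c => by
    rw [Commute, SemiconjBy, ← map_mul_of_dev_eq_one (hx a b _).1,
      ← map_mul_of_dev_eq_one (hx a b _).2, (gc a b c).eq]
  have hl : ∀ a a' b, dev f (g (a * a')) b = dev f (g a) b * dev f (g a') b := fun a a' b => by
    rw [map_mul_eq_dev_mul g, fl, fl, (hx _ _ _).1, one_mul]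
  have hr : ∀ a b b', dev f a (g (b * b')) = dev f a (g b) * dev f a (g b') := fun a b b' => by
    rw [map_mul_eq_dev_mul g, fr, fr, (hx _ _ _).2, one_mul]
  refine ⟨⟨⟨fun a a' b => ?_, fun a b b' => ?_, fun a b c => ?_⟩, fun a b hab => ?_⟩, key⟩
  · rw [key, key, key, gl, map_mul_of_dev_eq_one (hx _ _ _).1, hl]
    exact ((fc _ _ _).symm).mul_mul_mul_comm _ _
  · rw [key, key, key, gr, map_mul_of_dev_eq_one (hx _ _ _).1, hr]
    exact ((fc _ _ _).symm).mul_mul_mul_comm _ _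
  · rw [key]
    exact (hcomm a b c).mul_left (fc _ _ _)
  · rw [key, hgA' a b hab, hf1, one_mul]
    exact hfB _ _ (hab.imp (hgA a) (hgA b))
end

section
/- Let G be a group generated by a subset X. Then the group Q(G) is generated by the set {(0, x) : x ∈ X} ∪ {(x̄ ⊗ ȳ, 1) : x, y ∈ X}, i.e. by q(X) together with the values d_q(x,y) for x, y ∈ X. -/
open scoped TensorProduct

/-- The abelian group `G^{ab} ⊗_ℤ G^{ab}`. -/
abbrev QAb (G : Type*) [Group G] := Additive (Abelianization G) ⊗[ℤ] Additive (Abelianization G)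

/-- The canonical map `G → G^{ab}` (written additively). -/
def mab {G : Type*} [Group G] (a : G) : Additive (Abelianization G) :=
  Additive.ofMul (Abelianization.of a)

theorem mab_mul {G : Type*} [Group G] (a b : G) : mab (a * b) = mab a + mab b := rfl

theorem mab_one {G : Type*} [Group G] : mab (1 : G) = 0 := rfl

theorem mab_inv {G : Type*} [Group G] (a : G) : mab a⁻¹ = -mab a := rfl

theorem mab_surjective {G : Type*} [Group G] : Function.Surjective (mab (G := G)) := fun a =>
  QuotientGroup.mk_surjective a.toMul

/-- An additive subgroup of `G^{ab} ⊗ G^{ab}` containing the tensors of generators is everything. -/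
theorem mem_of_tmul_mem_of_closure_eq_top {G : Type*} [Group G] {X : Set G}
    (hX : Subgroup.closure X = ⊤) (K : AddSubgroup (QAb G))
    (hK : ∀ x ∈ X, ∀ y ∈ X, mab x ⊗ₜ[ℤ] mab y ∈ K) (t : QAb G) : t ∈ K := by
  have mem_closure (g : G) : g ∈ Subgroup.closure X := hX ▸ Subgroup.mem_top g
  have left_gen (x : G) (hx : x ∈ X) (h : G) : mab x ⊗ₜ[ℤ] mab h ∈ K := by
    induction mem_closure h using Subgroup.closure_induction with
    | mem y hy => exact hK x hx y hy
    | one => simp [mab_one, K.zero_mem]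
    | mul a b _ _ ha hb => rw [mab_mul, TensorProduct.tmul_add]; exact K.add_mem ha hb
    | inv a _ ha => rw [mab_inv, TensorProduct.tmul_neg]; exact K.neg_mem ha
  have pure_mem (g h : G) : mab g ⊗ₜ[ℤ] mab h ∈ K := by
    induction mem_closure g using Subgroup.closure_induction with
    | mem x hx => exact left_gen x hx h
    | one => simp [mab_one, K.zero_mem]
    | mul a b _ _ ha hb => rw [mab_mul, TensorProduct.add_tmul]; exact K.add_mem ha hb
    | inv a _ ha => rw [mab_inv, TensorProduct.neg_tmul]; exact K.neg_mem ha
  induction t using TensorProduct.induction_on with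
  | zero => exact K.zero_mem
  | tmul a b =>
    obtain ⟨g, rfl⟩ := mab_surjective a
    obtain ⟨h, rfl⟩ := mab_surjective b
    exact pure_mem g h
  | add a b ha hb => exact K.add_mem ha hb

theorem stmt10 {G : Type*} [Group G] (X : Set G) (hX : Subgroup.closure X = ⊤) :
    ∀ inst : Group (QAb G × G),
      letI := inst
      ((∀ p q : QAb G × G, p * q = (p.1 + q.1 - mab p.2 ⊗ₜ[ℤ] mab q.2, p.2 * q.2)) →
        Subgroup.closure
          ({p : QAb G × G | ∃ x ∈ X, p = ((0 : QAb G), x)} ∪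
            {p : QAb G × G | ∃ x ∈ X, ∃ y ∈ X, p = (mab x ⊗ₜ[ℤ] mab y, (1 : G))}) = ⊤) := by
  intro inst hmul
  set H := Subgroup.closure
    ({p : QAb G × G | ∃ x ∈ X, p = ((0 : QAb G), x)} ∪
      {p : QAb G × G | ∃ x ∈ X, ∃ y ∈ X, p = (mab x ⊗ₜ[ℤ] mab y, (1 : G))})
  have central_mul (t s : QAb G) (g : G) : ((t, 1) : QAb G × G) * (s, g) = (t + s, g) := by
    rw [hmul]; simp [mab_one]
  have one_eq : ((0, 1) : QAb G × G) = inst.one := by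
    have h : ((0, 1) : QAb G × G) * (0, 1) = (0, 1) := by rw [central_mul, add_zero]
    exact mul_eq_left.mp h
  have one_mem : ((0, 1) : QAb G × G) ∈ H := by rw [one_eq]; exact H.one_mem
  let K : AddSubgroup (QAb G) :=
    { carrier := {t | ((t, 1) : QAb G × G) ∈ H}
      zero_mem' := one_mem
      add_mem' := fun {s t} hs ht => by
        have h := H.mul_mem hs ht
        rwa [central_mul] at h
      neg_mem' := fun {t} ht => by
        have h : ((t, 1) : QAb G × G) * (-t, 1) ∈ H := by
          rw [central_mul, add_neg_cancel]; exact one_mem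
        exact (H.mul_mem_cancel_left ht).mp h }
  have central_mem (t : QAb G) : ((t, 1) : QAb G × G) ∈ H :=
    mem_of_tmul_mem_of_closure_eq_top hX K
      (fun x hx y hy => Subgroup.subset_closure (Or.inr ⟨x, hx, y, hy, rfl⟩)) t
  have shift (s t : QAb G) (g : G) (h : ((s, g) : QAb G × G) ∈ H) :
      ((t, g) : QAb G × G) ∈ H := by
    have h' := H.mul_mem (central_mem (t - s)) h
    rwa [central_mul, sub_add_cancel] at h'
  have lift_mem (g : G) : ((0, g) : QAb G × G) ∈ H := by
    induction (hX ▸ Subgroup.mem_top g : g ∈ Subgroup.closure X) using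
      Subgroup.closure_induction with
    | mem x hx => exact Subgroup.subset_closure (Or.inl ⟨x, hx, rfl⟩)
    | one => exact one_mem
    | mul a b _ _ ha hb =>
      have h := H.mul_mem ha hb
      rw [hmul] at h
      exact shift _ _ _ h
    | inv a _ ha =>
      refine (H.mul_mem_cancel_left ha).mp ?_
      rw [hmul]
      simp only [mul_inv_cancel]
      exact central_mem _
  exact (Subgroup.eq_top_iff' H).mpr fun p => shift 0 p.1 p.2 (lift_mem p.2)
end
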